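/- Let n ≥ 0 and let (T, B) be a descent matching with T ⊆ [n]. Then, in the polynomial ring ℤ[p, q], Σ_{σ ∈ S_n, Destop(σ)=T, Desbot(σ)=B} p^{(2-31)σ} q^{(31-2)σ} = Π_{i=1}^{n} [sg_{n,(T,B)}(i)]_{p,q}. -/

import Mathlib

open scoped Classical

/-- The 1-based `i`-th entry of a permutation `σ` of `{1,…,n}`, as a value in `{1,…,n}`
(one-line notation `σ(1)…σ(n)`). -/
def entry {n : ℕ} (σ : Equiv.Perm (Fin n)) (i : ℕ) : ℕ :=
  if h : i - 1 < n then (σ ⟨i - 1, h⟩ : ℕ) + 1 else 0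

/-- `σ` contains the pattern `π ∈ S_k` (given in 0-based one-line notation as a function):
there is a (not necessarily consecutive) subsequence of `σ` order-isomorphic to `π`. -/
def Contains {n k : ℕ} (π : Fin k → Fin k) (σ : Equiv.Perm (Fin n)) : Prop :=
  ∃ f : Fin k → Fin n, StrictMono f ∧ ∀ i j : Fin k, π i < π j ↔ σ (f i) < σ (f j)

/-- `σ` avoids the pattern `π`. -/
def AvoidsPat {n k : ℕ} (π : Fin k → Fin k) (σ : Equiv.Perm (Fin n)) : Prop :=
  ¬ Contains π σ

/-- The descent set of `σ` (1-based positions `i ∈ [n-1]` with `σ(i) > σ(i+1)`). -/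
def Des {n : ℕ} (σ : Equiv.Perm (Fin n)) : Finset ℕ :=
  (Finset.Icc 1 (n - 1)).filter (fun i => entry σ (i + 1) < entry σ i)

/-- The descent top set of `σ`: `{σ(i) : i ∈ Des σ}`. -/
def Destop {n : ℕ} (σ : Equiv.Perm (Fin n)) : Finset ℕ :=
  (Des σ).image (entry σ)

/-- The descent bottom set of `σ`: `{σ(i+1) : i ∈ Des σ}`. -/
def Desbot {n : ℕ} (σ : Equiv.Perm (Fin n)) : Finset ℕ :=
  (Des σ).image (fun i => entry σ (i + 1))

/-- The ascent set of `σ` (1-based positions `i ∈ [n-1]` with `σ(i) < σ(i+1)`). -/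
def Asc {n : ℕ} (σ : Equiv.Perm (Fin n)) : Finset ℕ :=
  (Finset.Icc 1 (n - 1)).filter (fun i => entry σ i < entry σ (i + 1))

/-- The ascent top set of `σ`: `{σ(i+1) : i ∈ Asc σ}`. -/
def Asctop {n : ℕ} (σ : Equiv.Perm (Fin n)) : Finset ℕ :=
  (Asc σ).image (fun i => entry σ (i + 1))

/-- The ascent bottom set of `σ`: `{σ(i) : i ∈ Asc σ}`. -/
def Ascbot {n : ℕ} (σ : Equiv.Perm (Fin n)) : Finset ℕ :=
  (Asc σ).image (entry σ)

/-- The set of peak values of `σ`. -/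
def Peak {n : ℕ} (σ : Equiv.Perm (Fin n)) : Finset ℕ :=
  Destop σ ∩ Asctop σ

/-- The set of valley values of `σ`. -/
def Val {n : ℕ} (σ : Equiv.Perm (Fin n)) : Finset ℕ :=
  Desbot σ ∩ Ascbot σ

/-- The set of left-to-right maxima (as values) of `σ`. -/
noncomputable def LRmax {n : ℕ} (σ : Equiv.Perm (Fin n)) : Finset ℕ :=
  ((Finset.Icc 1 n).filter (fun i => ∀ j, 1 ≤ j → j < i → entry σ j < entry σ i)).image (entry σ)

/-- The set of left-to-right minima (as values) of `σ`. -/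
noncomputable def LRmin {n : ℕ} (σ : Equiv.Perm (Fin n)) : Finset ℕ :=
  ((Finset.Icc 1 n).filter (fun i => ∀ j, 1 ≤ j → j < i → entry σ i < entry σ j)).image (entry σ)

/-- The set of right-to-left maxima (as values) of `σ`. -/
noncomputable def RLmax {n : ℕ} (σ : Equiv.Perm (Fin n)) : Finset ℕ :=
  ((Finset.Icc 1 n).filter (fun i => ∀ j, i < j → j ≤ n → entry σ j < entry σ i)).image (entry σ)

/-- The set of right-to-left minima (as values) of `σ`. -/
noncomputable def RLmin {n : ℕ} (σ : Equiv.Perm (Fin n)) : Finset ℕ :=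
  ((Finset.Icc 1 n).filter (fun i => ∀ j, i < j → j ≤ n → entry σ i < entry σ j)).image (entry σ)

/-- `(T, B)` is a descent matching: `T` and `B` are finite sets of positive integers
with `|T| = |B| = k`, and writing `T = {t_1 < … < t_k}`, `B = {b_1 < … < b_k}`,
we have `t_i > b_i` for all `i ∈ [k]`. -/
def DescentMatching (T B : Finset ℕ) : Prop :=
  T.card = B.card ∧ (∀ t ∈ T, 0 < t) ∧ (∀ b ∈ B, 0 < b) ∧
    ∀ i < T.card, (B.sort (· ≤ ·)).getD i 0 < (T.sort (· ≤ ·)).getD i 0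

/-- `(2_v 31)σ`: the number of occurrences of the vincular pattern `2-31` in `σ`
in which the "2" has value `v`. -/
def occ2_31at {n : ℕ} (σ : Equiv.Perm (Fin n)) (v : ℕ) : ℕ :=
  ((Finset.Icc 1 (n - 1) ×ˢ Finset.Icc 1 (n - 1)).filter
    (fun p => p.1 < p.2 ∧ entry σ (p.2 + 1) < entry σ p.2 ∧
      entry σ (p.2 + 1) < entry σ p.1 ∧ entry σ p.1 = v ∧ v < entry σ p.2)).card

/-- `(31 2_v)σ`: the number of occurrences of the vincular pattern `31-2` in `σ`
in which the "2" has value `v`. -/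
def occ31_2at {n : ℕ} (σ : Equiv.Perm (Fin n)) (v : ℕ) : ℕ :=
  ((Finset.Icc 1 (n - 1) ×ˢ Finset.Icc 1 n).filter
    (fun p => p.1 + 1 < p.2 ∧ entry σ (p.1 + 1) < entry σ p.1 ∧
      entry σ (p.1 + 1) < entry σ p.2 ∧ entry σ p.2 = v ∧ v < entry σ p.1)).card

/-- `(2-31)σ`: the number of occurrences of the vincular pattern `2-31` in `σ`. -/
def occ2_31 {n : ℕ} (σ : Equiv.Perm (Fin n)) : ℕ :=
  ((Finset.Icc 1 (n - 1) ×ˢ Finset.Icc 1 (n - 1)).filter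
    (fun p => p.1 < p.2 ∧ entry σ (p.2 + 1) < entry σ p.2 ∧
      entry σ (p.2 + 1) < entry σ p.1 ∧ entry σ p.1 < entry σ p.2)).card

/-- `(31-2)σ`: the number of occurrences of the vincular pattern `31-2` in `σ`. -/
def occ31_2 {n : ℕ} (σ : Equiv.Perm (Fin n)) : ℕ :=
  ((Finset.Icc 1 (n - 1) ×ˢ Finset.Icc 1 n).filter
    (fun p => p.1 + 1 < p.2 ∧ entry σ (p.1 + 1) < entry σ p.1 ∧
      entry σ (p.1 + 1) < entry σ p.2 ∧ entry σ p.2 < entry σ p.1)).card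

/-- The signature function `sg_{(T,B)}(i) = |B_{<i}| - |T_{≤i}| + 1`. -/
def sg (T B : Finset ℕ) (i : ℕ) : ℕ :=
  (B.filter (fun b => b < i)).card - (T.filter (fun t => t ≤ i)).card + 1

/-- The `(p,q)`-integer `[m]_{p,q} = Σ_{a+b=m-1} p^a q^b`. -/
def genQInt {R : Type*} [CommRing R] (m : ℕ) (p q : R) : R :=
  ∑ a ∈ Finset.range m, p ^ a * q ^ (m - 1 - a)

/-- The reverse complement of `σ`: `σ^{rc}(i) = n + 1 - σ(n + 1 - i)`. -/
def revComp {n : ℕ} (σ : Equiv.Perm (Fin n)) : Equiv.Perm (Fin n) :=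
  (Fin.revPerm.trans σ).trans Fin.revPerm


/-- adjacency relation of a valid word -/
def Adj (N : ℕ) (T B : Finset ℕ) (a b : ℕ) : Prop :=
  ¬ (a = N ∧ b = N) ∧ (a ≠ N → (b < a ↔ a ∈ T)) ∧ (b ≠ N → (b < a ↔ b ∈ B))

structure Valid (N : ℕ) (T B : Finset ℕ) (i : ℕ) (w : List ℕ) : Prop where
  mem : ∀ x ∈ w, (1 ≤ x ∧ x ≤ i) ∨ x = N
  cnt : ∀ x, 1 ≤ x → x ≤ i → w.count x = 1
  chain : List.IsChain (Adj N T B) (0 :: w)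
  last : ∃ w0, w = w0 ++ [N]

def pre (N : ℕ) (B : Finset ℕ) (i : ℕ) : List ℕ := if i ∈ B then [N] else []
def post (N : ℕ) (T : Finset ℕ) (i : ℕ) : List ℕ := if i ∈ T then [] else [N]

def newW (N : ℕ) (T B : Finset ℕ) (i : ℕ) (s : List ℕ × List ℕ) : List ℕ :=
  s.1 ++ (pre N B i ++ i :: (post N T i ++ s.2))

def spl (N : ℕ) : List ℕ → List (List ℕ × List ℕ)
  | [] => []
  | x :: w => (if x = N then [([], w)] else []) ++ (spl N w).map (fun s => (x :: s.1, s.2))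

def states (N : ℕ) (T B : Finset ℕ) : ℕ → List (List ℕ)
  | 0 => [[N]]
  | i + 1 => (states N T B i).flatMap fun w =>
      ((spl N w).filter (fun s => i + 1 ∈ T → s.2 ≠ [])).map (newW N T B (i + 1))

/-- number of descents in the word straddling `x` -/
def dcnt (x : ℕ) : List ℕ → ℕ
  | [] => 0
  | y :: w => (if w.headD (y + 1) < x ∧ x < y then 1 else 0) + dcnt x w

def pst : List ℕ → ℕ
  | [] => 0
  | x :: w => dcnt x w + pst w

def inbt (z y x : ℕ) : Bool := decide (z < x ∧ x < y)

lemma inbt_iff (z y x : ℕ) : inbt z y x = true ↔ z < x ∧ x < y := by simp [inbt]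

def qst : List ℕ → ℕ
  | [] => 0
  | y :: w => w.countP (inbt (w.headD 0) y) + qst w

lemma nil_or_snoc (l : List ℕ) : l = [] ∨ ∃ l' z, l = l' ++ [z] := by
  rcases List.eq_nil_or_concat l with h | ⟨l', z, h⟩
  · exact Or.inl h
  · exact Or.inr ⟨l', z, by simp [h]⟩

@[simp] lemma gl_snoc (x z : ℕ) (l : List ℕ) : (x :: (l ++ [z])).getLast? = some z := by
  rw [← List.cons_append, List.getLast?_append]; simp

lemma mem_spl (N : ℕ) (w : List ℕ) (s : List ℕ × List ℕ) :
    s ∈ spl N w ↔ w = s.1 ++ N :: s.2 := by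
  induction w generalizing s with
  | nil => simp [spl]
  | cons x w ih =>
    obtain ⟨u, v⟩ := s
    simp only [spl, List.mem_append, List.mem_map, Prod.mk.injEq]
    cases u with
    | nil => 
      by_cases h : x = N
      · simp [h, eq_comm]
      · simp [h]
    | cons a u =>
      by_cases h : x = N <;> simp [h, ih]
      · aesop
      · aesop

lemma nodup_spl (N : ℕ) (w : List ℕ) : (spl N w).Nodup := by
  induction w with
  | nil => simp [spl]
  | cons x w ih =>
    have h2 : ((spl N w).map (fun s => (x :: s.1, s.2))).Nodup := by
      apply List.Nodup.map _ ih
      rintro ⟨a, b⟩ ⟨c, d⟩ h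
      simpa using h
    by_cases h : x = N
    · simp [spl, h, h2]
      simpa [h] using h2
    · simp [spl, h, h2]

lemma valid_new {N i : ℕ} {T B : Finset ℕ} {u v : List ℕ} (hi : i + 1 < N)
    (hv : Valid N T B i (u ++ N :: v)) (hT : i + 1 ∈ T → v ≠ []) :
    Valid N T B (i + 1) (newW N T B (i + 1) (u, v)) := by
  obtain ⟨hm, hc, hch, w0, hl⟩ := hv
  refine ⟨?_, ?_, ?_, ?_⟩
  · intro x hx
    simp only [newW, pre, post] at hx
    have := hm x
    simp only [List.mem_append, List.mem_cons] at *
    by_cases h1 : i + 1 ∈ B <;> by_cases h2 : i + 1 ∈ T <;> simp [h1, h2] at hx <;> grind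
  · intro x h1x hxi
    have hN : ¬ N = x := by omega
    have h1 : (pre N B (i+1)).count x = 0 := by
      unfold pre; split_ifs <;> simp [hN]
    have h2 : (post N T (i+1)).count x = 0 := by
      unfold post; split_ifs <;> simp [hN]
    simp only [newW, List.count_append, List.count_cons, h1, h2]
    by_cases hx : x = i + 1
    · have hu : (u ++ N :: v).count x = 0 := by
        rw [List.count_eq_zero]
        intro h
        have := hm x h
        omega
      simp only [List.count_append, List.count_cons] at hu
      simp [hx] at *
      omega
    · have := hc x h1x (by omega)
      simp only [List.count_append, List.count_cons] at this
      have h3 : ¬ i + 1 = x := by omega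
      simp [h3, hN] at *
      omega
  · rw [← List.cons_append, List.isChain_append] at hch
    obtain ⟨c1, c2, c3⟩ := hch
    have ha : ∃ a, (0 :: u).getLast? = some a ∧ (a ≤ i ∨ a = N) := by
      refine ⟨(0 :: u).getLast (by simp), List.getLast?_eq_some_getLast _, ?_⟩
      have := List.getLast_mem (l := 0 :: u) (by simp)
      rw [List.mem_cons] at this
      rcases this with h | h
      · omega
      · have := hm _ (List.mem_append_left _ h); omega
    obtain ⟨a, ha, hai⟩ := ha
    have c3 : Adj N T B a N := c3 a (by simp [ha]) N (by simp)
    have hR : List.IsChain (Adj N T B) ((i + 1) :: (post N T (i+1) ++ v)) := by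
      unfold post
      split_ifs with h
      · cases v with
        | nil => simp
        | cons y v =>
          simp only [List.nil_append, List.isChain_cons_cons] at c2 ⊢
          refine ⟨?_, c2.2⟩
          have := c2.1
          have hy := hm y (by simp)
          unfold Adj at *
          grind
      · simp only [List.cons_append, List.nil_append, List.isChain_cons_cons]
        refine ⟨?_, c2⟩
        unfold Adj
        grind
    rw [newW, ← List.cons_append, List.isChain_append]
    refine ⟨c1, ?_, ?_⟩
    · unfold pre
      split_ifs with h
      · simp only [List.cons_append, List.nil_append, List.isChain_cons_cons]
        refine ⟨?_, hR⟩
        unfold Adj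
        grind
      · simpa using hR
    · simp only [ha, Option.mem_some_iff]
      rintro x rfl y hy
      unfold pre at hy
      split_ifs at hy with h
      · simp at hy; subst hy; exact c3
      · simp at hy; subst hy
        unfold Adj at *
        grind
  · simp only [newW, post]
    rcases nil_or_snoc v with rfl | ⟨v', z, rfl⟩
    · have h : i + 1 ∉ T := fun h => hT h rfl
      refine ⟨u ++ (pre N B (i+1) ++ [i+1]), ?_⟩
      simp [h]
    · have : z = N := by
        have := congrArg List.getLast? hl
        simpa using this
      subst this
      refine ⟨u ++ (pre z B (i+1) ++ (i+1) :: (post z T (i+1) ++ v')), ?_⟩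
      simp [post]

lemma valid_old {N i : ℕ} {T B : Finset ℕ} {w : List ℕ} (hi : i + 1 < N)
    (hv : Valid N T B (i + 1) w) :
    ∃ u v, w = newW N T B (i + 1) (u, v) ∧ (i + 1 ∈ T → v ≠ []) ∧
      Valid N T B i (u ++ N :: v) := by
  obtain ⟨hm, hc, hch, w0, hl⟩ := hv
  have hw : i + 1 ∈ w := by
    rw [← List.count_pos_iff, hc (i+1) (by omega) le_rfl]; omega
  obtain ⟨a, c, rfl⟩ := List.append_of_mem hw
  have hne : ∀ x ∈ a ++ c, (1 ≤ x ∧ x ≤ i) ∨ x = N := by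
    intro x hx
    have h1 := hm x (by simp at hx ⊢; tauto)
    have : x ≠ i + 1 := by
      rintro rfl
      have := hc (i+1) (by omega) le_rfl
      have h2 := List.count_pos_iff.2 hx
      simp only [List.count_append, List.count_cons_self] at this h2
      omega
    omega
  have hcl : ∃ c', (i+1) :: c = c' ++ [N] := by
    rcases nil_or_snoc c with rfl | ⟨v', z, rfl⟩
    · have := congrArg List.getLast? hl
      simp at this; omega
    · have := congrArg List.getLast? hl
      simp at this
      exact ⟨(i+1)::v', by simp [this]⟩
  rw [← List.cons_append, List.isChain_append] at hch
  obtain ⟨c1, c2, c3⟩ := hch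
  have hR : ∃ v, c = post N T (i+1) ++ v ∧ (i + 1 ∈ T → v ≠ []) ∧
      List.IsChain (Adj N T B) (N :: v) ∧ ∃ v', N :: v = v' ++ [N] := by
    cases c with
    | nil =>
      obtain ⟨c', h⟩ := hcl
      have := congrArg List.getLast? h
      simp at this; omega
    | cons y c =>
      rw [List.isChain_cons_cons] at c2
      obtain ⟨hA, c2⟩ := c2
      by_cases hy : y = N
      · subst hy
        have hT : i + 1 ∉ T := by unfold Adj at hA; grind
        refine ⟨c, by simp [post, hT], fun h => absurd h hT, c2, ?_⟩
        rcases nil_or_snoc c with rfl | ⟨v', z, rfl⟩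
        · exact ⟨[], rfl⟩
        · have := congrArg List.getLast? hl
          simp at this
          exact ⟨y :: v', by simp [this]⟩
      · have hyi := hne y (by simp)
        have hT : i + 1 ∈ T := by unfold Adj at hA; grind
        refine ⟨y :: c, by simp [post, hT], by simp, ?_, ?_⟩
        · rw [List.isChain_cons_cons]
          refine ⟨?_, c2⟩
          unfold Adj at *; grind
        · rcases nil_or_snoc c with rfl | ⟨v', z, rfl⟩
          · have := congrArg List.getLast? hl
            simp at this; omega
          · have := congrArg List.getLast? hl
            simp at this
            exact ⟨N :: y :: v', by simp [this]⟩
  obtain ⟨v, rfl, hvT, hcv, v', hv'⟩ := hR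
  have hL : ∃ u, a = u ++ pre N B (i+1) ∧ List.IsChain (Adj N T B) (0 :: u) ∧
      ∀ x ∈ (0 :: u).getLast?, Adj N T B x N := by
    rcases nil_or_snoc a with rfl | ⟨u', z, rfl⟩
    · have := c3 0 (by simp) (i+1) (by simp)
      refine ⟨[], ?_, by simp, ?_⟩
      · unfold Adj at this
        have : i + 1 ∉ B := by grind
        simp [pre, this]
      · simp
        unfold Adj at *
        grind
    · have hA := c3 z (by simp) (i+1) (by simp)
      by_cases hz : z = N
      · subst hz
        have hB : i + 1 ∈ B := by unfold Adj at hA; grind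
        rw [← List.cons_append, List.isChain_append] at c1
        refine ⟨u', by simp [pre, hB], c1.1, ?_⟩
        intro x hx
        exact c1.2.2 x hx z (by simp)
      · have hzi := hne z (by simp)
        have hB : i + 1 ∉ B := by unfold Adj at hA; grind
        refine ⟨u' ++ [z], by simp [pre, hB], c1, ?_⟩
        intro x hx
        rw [← List.cons_append] at hx
        simp at hx
        subst hx
        unfold Adj at *; grind
  obtain ⟨u, rfl, hcu, hcl⟩ := hL
  refine ⟨u, v, by simp [newW], hvT, ?_, ?_, ?_, ?_⟩
  · intro x hx
    have := hne x
    simp at hx this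
    grind
  · intro x h1 h2
    have hN : ¬ N = x := by omega
    have hix : ¬ i + 1 = x := by omega
    have e1 : (pre N B (i+1)).count x = 0 := by
      unfold pre; split_ifs <;> simp [hN]
    have e2 : (post N T (i+1)).count x = 0 := by
      unfold post; split_ifs <;> simp [hN]
    have := hc x h1 (by omega)
    simp [List.count_append, List.count_cons, e1, e2, hN, hix] at this ⊢
    omega
  · rw [← List.cons_append, List.isChain_append]
    refine ⟨hcu, hcv, ?_⟩
    intro x hx y hy
    simp at hy; subst hy
    exact hcl x hx
  · exact ⟨u ++ v', by simp [hv']⟩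

lemma valid_zero {N : ℕ} {T B : Finset ℕ} (hN : 0 < N) (h0 : 0 ∉ T) (w : List ℕ) :
    Valid N T B 0 w ↔ w = [N] := by
  constructor
  · rintro ⟨hm, -, hch, w0, rfl⟩
    rcases nil_or_snoc w0 with rfl | ⟨l, z, rfl⟩
    · rfl
    · exfalso
      have hz := hm z (by simp)
      rw [← List.cons_append, List.isChain_append] at hch
      have := hch.2.2 z (by simp) N (by simp)
      unfold Adj at this
      grind
  · rintro rfl
    refine ⟨by simp, by intros; omega, ?_, [], rfl⟩
    simp [Adj]
    grind

lemma mem_states {N : ℕ} {T B : Finset ℕ} (h0 : 0 ∉ T) (i : ℕ) (hi : i < N) (w : List ℕ) :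
    w ∈ states N T B i ↔ Valid N T B i w := by
  induction i generalizing w with
  | zero => rw [valid_zero hi h0]; simp [states]
  | succ i ih =>
    simp only [states, List.mem_flatMap, List.mem_map, List.mem_filter, mem_spl,
      decide_eq_true_eq]
    constructor
    · rintro ⟨w, hw, ⟨u, v⟩, ⟨rfl, hv⟩, rfl⟩
      rw [ih (by omega)] at hw
      exact valid_new hi hw hv
    · intro h
      obtain ⟨u, v, rfl, hv, hw⟩ := valid_old hi h
      exact ⟨_, (ih (by omega) _).2 hw, (u, v), ⟨rfl, hv⟩, rfl⟩

lemma valid_notMem {N i k : ℕ} {T B : Finset ℕ} {w : List ℕ} (hv : Valid N T B i w)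
    (hi : i < k) (hk : k < N) : k ∉ w := by
  intro h
  have := hv.mem k h
  omega

lemma newW_inj {N k : ℕ} {T B : Finset ℕ} {s t : List ℕ × List ℕ} (hk : k < N)
    (hs : k ∉ s.1 ++ N :: s.2) (ht : k ∉ t.1 ++ N :: t.2)
    (h : newW N T B k s = newW N T B k t) : s = t := by
  obtain ⟨u, v⟩ := s
  obtain ⟨u', v'⟩ := t
  simp only [newW, ← List.append_assoc] at h
  have hp : k ∉ pre N B k := by unfold pre; split_ifs <;> simp; omega
  have h1 : k ∉ u ++ pre N B k := by simp at hs ⊢; tauto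
  have h2 : k ∉ u' ++ pre N B k := by simp at ht ⊢; tauto
  have hq : k ∉ post N T k := by unfold post; split_ifs <;> simp; omega
  have h3 : k ∉ post N T k ++ v := by simp at hs ⊢; tauto
  have h4 : k ∉ post N T k ++ v' := by simp at ht ⊢; tauto
  have h := (List.append_cons_inj_of_notMem h1 h3).1 h
  simp at h
  simp [h]

lemma nodup_states {N : ℕ} {T B : Finset ℕ} (h0 : 0 ∉ T) (i : ℕ) (hi : i < N) :
    (states N T B i).Nodup := by
  induction i with
  | zero => simp [states]
  | succ i ih =>
    have ih := ih (by omega)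
    simp only [states]
    rw [List.nodup_flatMap]
    constructor
    · intro w hw
      rw [mem_states h0 i (by omega)] at hw
      apply List.Nodup.map_on _ ((nodup_spl N w).filter _)
      intro s hs t ht h
      simp only [List.mem_filter, mem_spl] at hs ht
      refine newW_inj hi ?_ ?_ h
      · rw [← hs.1]; exact valid_notMem hw (by omega) hi
      · rw [← ht.1]; exact valid_notMem hw (by omega) hi
    · refine List.Pairwise.imp_of_mem ?_ ih
      intro a b ha hb hab
      rw [mem_states h0 i (by omega)] at ha hb
      rw [Function.onFun, List.disjoint_left]
      intro x hx hx'
      simp only [List.mem_map, List.mem_filter, mem_spl] at hx hx'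
      obtain ⟨s, ⟨hs, -⟩, rfl⟩ := hx
      obtain ⟨t, ⟨ht, -⟩, h⟩ := hx'
      apply hab
      have := newW_inj hi (by rw [← ht]; exact valid_notMem hb (by omega) hi)
        (by rw [← hs]; exact valid_notMem ha (by omega) hi) h
      rw [hs, ht, this]

lemma filter_le_succ (T : Finset ℕ) (i : ℕ) :
    (T.filter (fun t => t ≤ i + 1)).card =
      (T.filter (fun t => t ≤ i)).card + if i + 1 ∈ T then 1 else 0 := by
  have : T.filter (fun t => t ≤ i + 1) =
      T.filter (fun t => t ≤ i) ∪ T.filter (fun t => t = i + 1) := by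
    ext x; simp; constructor
    · rintro ⟨h, h2⟩
      by_cases hx : x ≤ i
      · tauto
      · right; exact ⟨h, by omega⟩
    · rintro (h | h)
      · exact ⟨h.1, by omega⟩
      · exact ⟨h.1, by omega⟩
  rw [this, Finset.card_union_of_disjoint]
  · congr 1
    rw [Finset.filter_eq']
    split_ifs <;> simp
  · rw [Finset.disjoint_filter]; intros; omega

lemma count_N {N : ℕ} {T B : Finset ℕ} (h0 : 0 ∉ T) (h0B : 0 ∉ B) (i : ℕ) (hi : i < N)
    (w : List ℕ) (hw : w ∈ states N T B i) :
    w.count N + (T.filter (fun t => t ≤ i)).card = (B.filter (fun t => t ≤ i)).card + 1 := by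
  induction i generalizing w with
  | zero =>
    simp only [states, List.mem_singleton] at hw
    subst hw
    have e1 : T.filter (fun t => t ≤ 0) = ∅ := by
      ext x; simp; rintro h rfl; exact h0 h
    have e2 : B.filter (fun t => t ≤ 0) = ∅ := by
      ext x; simp; rintro h rfl; exact h0B h
    simp only [e1, e2]
    simp
  | succ i ih =>
    simp only [states, List.mem_flatMap, List.mem_map, List.mem_filter, mem_spl,
      decide_eq_true_eq] at hw
    obtain ⟨w, hw, ⟨u, v⟩, ⟨rfl, hv⟩, rfl⟩ := hw
    have := ih (by omega) _ hw
    rw [filter_le_succ, filter_le_succ]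
    have hN : ¬ i + 1 = N := by omega
    simp only [newW, pre, post, List.count_append, List.count_cons] at this ⊢
    split_ifs <;> simp [hN] at * <;> omega


lemma dcnt_append (x : ℕ) (u R R' : List ℕ)
    (h0 : dcnt x R = dcnt x R') (h : ∀ a ∈ u, dcnt x (a :: R) = dcnt x (a :: R')) :
    dcnt x (u ++ R) = dcnt x (u ++ R') := by
  induction u with
  | nil => simpa
  | cons a u ih =>
    cases u with
    | nil => simpa using h a (by simp)
    | cons b u =>
      have := ih (fun c hc => h c (List.mem_cons_of_mem _ hc))
      simp only [List.cons_append] at this ⊢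
      rw [dcnt, this]
      conv_rhs => rw [dcnt]
      simp

lemma dcnt_top (N : ℕ) (w : List ℕ) (h : ∀ x ∈ w, x ≤ N) : dcnt N w = 0 := by
  induction w with
  | nil => rfl
  | cons y w ih =>
    have := h y (by simp)
    rw [dcnt, ih (fun x hx => h x (by simp [hx]))]
    simp; omega

lemma dcnt_new {N k x : ℕ} {T B : Finset ℕ} {u v : List ℕ} (hk : k < N)
    (hu : ∀ a ∈ u, a < k ∨ a = N) (hx : x < k ∨ x = N) (hv : ∀ a ∈ v, a < k ∨ a = N)
    (hT : k ∈ T → v ≠ []) :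
    dcnt x (newW N T B k (u, v)) = dcnt x (u ++ N :: v) := by
  have e1 : dcnt x (k :: (post N T k ++ v)) = dcnt x (N :: v) := by
    unfold post
    split_ifs with h
    · cases v with
      | nil => exact absurd rfl (hT h)
      | cons y v =>
        have := hv y (by simp)
        simp only [List.nil_append, dcnt, List.headD_cons]
        grind
    · simp only [List.cons_append, List.nil_append, dcnt, List.headD_cons]
      have : ¬ (N < x ∧ x < k) := by omega
      simp [this]
  have e2 : dcnt x (pre N B k ++ k :: (post N T k ++ v)) = dcnt x (N :: v) := by
    unfold pre
    split_ifs with h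
    · rw [List.cons_append, List.nil_append, dcnt, e1, List.headD_cons]
      have : ¬ (k < x ∧ x < N) := by omega
      simp [this]
    · exact e1
  apply dcnt_append _ _ _ _ e2
  intro a ha
  have := hu a ha
  rw [dcnt, e2]
  conv_rhs => rw [dcnt]
  congr 1
  unfold pre
  split_ifs <;> grind

lemma pst_new {N k : ℕ} {T B : Finset ℕ} {u v : List ℕ} (hk : k < N)
    (hu : ∀ a ∈ u, a < k ∨ a = N) (hv : ∀ a ∈ v, a < k ∨ a = N)
    (hT : k ∈ T → v ≠ []) :
    pst (newW N T B k (u, v)) = pst (u ++ N :: v) + dcnt k (post N T k ++ v) := by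
  induction u with
  | nil =>
    have hle : ∀ a ∈ v, a ≤ N := fun a ha => by have := hv a ha; omega
    have e1 : pst (post N T k ++ v) = pst v := by
      unfold post; split_ifs
      · rfl
      · rw [List.cons_append, List.nil_append, pst, dcnt_top N v hle, zero_add]
    have e2 : pst (N :: v) = pst v := by rw [pst, dcnt_top N v hle, zero_add]
    have e3 : pst (k :: (post N T k ++ v)) = dcnt k (post N T k ++ v) + pst v := by
      rw [pst, e1]
    simp only [newW, List.nil_append, e2]
    unfold pre
    split_ifs
    · rw [List.cons_append, List.nil_append, pst, e3, dcnt_top N]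
      · omega
      · intro x hx
        simp at hx
        rcases hx with rfl | hx | hx
        · omega
        · unfold post at hx; split_ifs at hx <;> simp at hx; omega
        · exact hle x hx
    · rw [List.nil_append, e3, add_comm]
  | cons a u ih =>
    have := ih (fun c hc => hu c (by simp [hc]))
    have h2 := dcnt_new (B := B) (u := u) hk (fun c hc => hu c (by simp [hc])) (hu a (by simp)) hv hT
    have e : newW N T B k (a :: u, v) = a :: newW N T B k (u, v) := by simp [newW]
    rw [e, List.cons_append, pst, pst, this, h2]
    omega

lemma qst_new {N k : ℕ} {T B : Finset ℕ} {u v : List ℕ} (hk : k < N)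
    (hu : ∀ a ∈ u, a < k ∨ a = N) (hv : ∀ a ∈ v, a < k ∨ a = N)
    (hT : k ∈ T → v ≠ []) (hch : List.IsChain (fun a b => ¬ (a = N ∧ b = N)) (u ++ N :: v)) :
    qst (newW N T B k (u, v)) = qst (u ++ N :: v) + u.count N := by
  induction u with
  | nil =>
    have e1 : qst (k :: (post N T k ++ v)) = qst (N :: v) := by
      unfold post; split_ifs with h
      · rw [List.nil_append, qst, qst]
        congr 1
        apply List.countP_congr
        intro x hx
        have := hv x hx
        cases v with
        | nil => simp at hx
        | cons y v =>
          have := hv y (by simp)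
          simp at hch
          simp only [inbt_iff, List.headD_cons]
          omega
      · rw [List.cons_append, List.nil_append, qst, Nat.add_eq_right, List.countP_eq_zero]
        intro x hx
        simp only [inbt_iff, List.headD_cons]; omega
    simp only [newW, List.nil_append, List.count_nil, add_zero]
    unfold pre
    split_ifs
    · rw [List.cons_append, List.nil_append, qst, e1, Nat.add_eq_right, List.countP_eq_zero]
      intro x hx
      simp at hx
      simp only [inbt_iff, List.headD_cons]
      rcases hx with rfl | hx | hx
      · omega
      · unfold post at hx; split_ifs at hx <;> simp at hx; omega
      · have := hv x hx; omega
    · exact e1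
  | cons a u ih =>
    have := ih (fun c hc => hu c (by simp [hc])) (by
      rw [List.cons_append] at hch; exact hch.tail)
    have e : newW N T B k (a :: u, v) = a :: newW N T B k (u, v) := by simp [newW]
    rw [e, List.cons_append, qst, qst, this, List.count_cons]
    have ha := hu a (by simp)
    suffices h : List.countP (inbt ((newW N T B k (u, v)).headD 0) a)
        (newW N T B k (u, v)) = List.countP (inbt ((u ++ N :: v).headD 0) a)
        (u ++ N :: v) + if a == N then 1 else 0 by
      rw [h]; omega
    cases u with
    | nil =>
      simp at hch
      have haN : a ≠ N := by tauto
      have hak : a < k := by omega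
      simp only [List.nil_append, List.headD_cons, beq_iff_eq, haN, if_false, add_zero]
      rw [List.countP_eq_zero.2, List.countP_eq_zero.2]
      · intro x hx; simp only [inbt_iff]; omega
      · intro x hx
        have : k ≤ (newW N T B k ([], v)).headD 0 := by
          simp only [newW, pre]
          split_ifs <;> simp <;> omega
        rw [inbt_iff]
        omega
    | cons b u =>
      have hb := hu b (by simp)
      simp at hch
      have c1 : ∀ f : ℕ → Bool, f N = false → (pre N B k).countP f = 0 := by
        intro f hf; unfold pre; split_ifs <;> simp [hf]
      have c2 : ∀ f : ℕ → Bool, f N = false → (post N T k).countP f = 0 := by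
        intro f hf; unfold post; split_ifs <;> simp [hf]
      have hf : inbt b a N = false := by rw [Bool.eq_false_iff, Ne, inbt_iff]; omega
      simp only [newW, List.cons_append, List.headD_cons, List.countP_cons, List.countP_append]
      rw [c1 _ hf, c2 _ hf, hf]
      have : (b < k ∧ k < a) ↔ a = N := by omega
      simp only [inbt_iff, this, beq_iff_eq]
      simp
      omega

lemma dcnt_count {N k : ℕ} (hk : k < N) (w : List ℕ) (z : List ℕ) (hw : w = z ++ [N])
    (hm : ∀ a ∈ w, a < k ∨ a = N)
    (hch : List.IsChain (fun a b => ¬ (a = N ∧ b = N)) w) :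
    dcnt k w + 1 = w.count N := by
  subst hw
  induction z with
  | nil => simp [dcnt]; omega
  | cons a z ih =>
    have := ih (fun c hc => hm c (by simp at hc ⊢; tauto)) (by
      rw [List.cons_append] at hch; exact hch.tail)
    rw [List.cons_append, dcnt, List.count_cons]
    have ha := hm a (by simp)
    cases z with
    | nil =>
      simp at hch
      simp [dcnt, hch]
      omega
    | cons b z =>
      have hb := hm b (by simp)
      simp only [List.cons_append, List.isChain_cons_cons] at hch
      have e : (b < k ∧ k < a) ↔ a = N := by omega
      simp only [List.cons_append, List.headD_cons, e, beq_iff_eq] at this ⊢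
      omega

lemma genQInt_succ {R : Type*} [CommRing R] (m : ℕ) (p q : R) :
    genQInt (m + 1) p q = p ^ m + q * genQInt m p q := by
  unfold genQInt
  rw [Finset.sum_range_succ, Finset.mul_sum, add_comm]
  congr 1
  · simp
  · apply Finset.sum_congr rfl
    intro a ha
    rw [Finset.mem_range] at ha
    have : m + 1 - 1 - a = (m - 1 - a) + 1 := by omega
    rw [this, pow_succ]; ring

lemma spl_sum1 {R : Type*} [CommRing R] (p q : R) (N : ℕ) (w : List ℕ) :
    ((spl N w).map fun s => q ^ (s.1.count N) * p ^ (s.2.count N)).sum =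
      genQInt (w.count N) p q := by
  induction w with
  | nil => simp [spl, genQInt]
  | cons x w ih =>
    by_cases h : x = N
    · subst h
      simp only [spl, if_true, List.count_cons_self, genQInt_succ, ← ih, List.map_append,
        List.sum_append, List.map_map, Function.comp_def, pow_succ', mul_assoc,
        List.sum_map_mul_left]
      simp
    · simp [spl, h, Function.comp_def, ih]

lemma spl_sum2 {R : Type*} [CommRing R] (p q : R) (N : ℕ) (z : List ℕ) :
    (((spl N (z ++ [N])).filter (fun s => s.2 ≠ [])).map
      fun s => q ^ (s.1.count N) * p ^ (s.2.count N - 1)).sum =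
      genQInt ((z ++ [N]).count N - 1) p q := by
  induction z with
  | nil => simp [spl, genQInt]
  | cons x w ih =>
    by_cases h : x = N
    · subst h
      have e : spl x (x :: w ++ [x]) =
          ([], w ++ [x]) :: (spl x (w ++ [x])).map (fun s => (x :: s.1, s.2)) := by
        simp [spl]
      have this : (w ++ [x]).count x = (w ++ [x]).count x - 1 + 1 := by
        simp [List.count_append]
      rw [e, List.cons_append, List.count_cons_self, Nat.add_sub_cancel, this, genQInt_succ, ← ih,
        List.filter_cons_of_pos (by simp), List.filter_map, List.map_cons, List.sum_cons,
        List.map_map, ← List.sum_map_mul_left]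
      congr 1
      · simp
      · congr 1
        apply List.map_congr_left
        intro s _
        simp [pow_succ', mul_assoc]
    · simp only [spl, h, if_false, List.nil_append, List.cons_append, List.filter_map,
        List.map_map, Function.comp_def, List.count_cons_of_ne h]
      exact ih

lemma states_sum {R : Type*} [CommRing R] (p q : R) {N : ℕ} {T B : Finset ℕ}
    (h0 : 0 ∉ T) (h0B : 0 ∉ B)
    (hd : ∀ i, (T.filter (fun t => t ≤ i)).card ≤ (B.filter (fun b => b < i)).card)
    (i : ℕ) (hi : i < N) :
    ((states N T B i).map fun w => p ^ pst w * q ^ qst w).sum =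
      ∏ j ∈ Finset.Icc 1 i, genQInt (sg T B j) p q := by
  induction i with
  | zero => simp [states, pst, qst, dcnt]
  | succ i ih =>
    rw [Finset.prod_Icc_succ_top (by omega), ← ih (by omega), ← List.sum_map_mul_right, states,
      List.map_flatMap, List.flatMap_def, List.sum_flatten, List.map_map]
    congr 1
    apply List.map_congr_left
    intro w hw
    have hcount := count_N h0 h0B i (by omega) w hw
    rw [mem_states h0 i (by omega)] at hw
    have hch0 : List.IsChain (fun a b => ¬ (a = N ∧ b = N)) w := by
      refine List.IsChain.imp (fun a b hab => hab.1) (List.IsChain.tail hw.chain)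
    have hsg : sg T B (i + 1) = w.count N - if i + 1 ∈ T then 1 else 0 := by
      have h1 := hd (i + 1)
      have h2 := filter_le_succ T i
      have h3 : B.filter (fun b => b < i + 1) = B.filter (fun b => b ≤ i) := by
        ext x; simp [Nat.lt_succ_iff]
      unfold sg
      rw [h3] at h1 ⊢
      split_ifs at h2 ⊢ <;> omega
    simp only [Function.comp_apply, List.map_map]
    have key : ∀ s ∈ (spl N w).filter (fun s => i + 1 ∈ T → s.2 ≠ []),
        p ^ pst (newW N T B (i + 1) s) * q ^ qst (newW N T B (i + 1) s) =
        p ^ pst w * q ^ qst w * (q ^ (s.1.count N) *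
          p ^ (s.2.count N - if i + 1 ∈ T then 1 else 0)) := by
      rintro ⟨u, v⟩ hs
      simp only [List.mem_filter, mem_spl, decide_eq_true_eq] at hs
      obtain ⟨rfl, hT⟩ := hs
      have hu : ∀ a ∈ u, a < i + 1 ∨ a = N := fun a ha => by
        have := hw.mem a (by simp [ha]); omega
      have hv : ∀ a ∈ v, a < i + 1 ∨ a = N := fun a ha => by
        have := hw.mem a (by simp [ha]); omega
      rw [pst_new hi hu hv hT, qst_new hi hu hv hT hch0]
      have hchv := (List.isChain_append.1 hch0).2.1
      obtain ⟨w0, hl⟩ := hw.last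
      have hd : dcnt (i + 1) (post N T (i + 1) ++ v) =
          v.count N - if i + 1 ∈ T then 1 else 0 := by
        rcases nil_or_snoc v with rfl | ⟨v', z, rfl⟩
        · have hT' : i + 1 ∉ T := fun h => hT h rfl
          simp [post, hT', dcnt]; omega
        · have : z = N := by
            have := congrArg List.getLast? hl
            simpa using this
          subst this
          unfold post
          split_ifs with h
          · have := dcnt_count hi (v' ++ [z]) v' rfl hv hchv.tail
            simp only [List.nil_append]
            omega
          · have := dcnt_count hi (z :: (v' ++ [z])) (z :: v') rfl
              (by intro a ha; rw [List.mem_cons] at ha; rcases ha with rfl | ha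
                  · right; rfl
                  · exact hv a ha) hchv
            rw [List.count_cons_self] at this
            simp only [List.cons_append, List.nil_append]
            omega
      rw [hd, pow_add, pow_add]
      ring
    simp only [Function.comp_def]
    rw [List.map_congr_left key, List.sum_map_mul_left, hsg]
    congr 1
    split_ifs with h
    · obtain ⟨z, rfl⟩ := hw.last
      rw [← spl_sum2]
      congr 2
      apply List.filter_congr
      intro s _
      simp [h]
    · rw [Nat.sub_zero, ← spl_sum1]
      congr 2
      · simp [h]

lemma matching_le {T B : Finset ℕ} (h : DescentMatching T B) (i : ℕ) :
    (T.filter (fun t => t ≤ i)).card ≤ (B.filter (fun b => b < i)).card := by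
  obtain ⟨hc, -, -, h⟩ := h
  have key : ∀ t ∈ T, (T.sort (· ≤ ·)).idxOf t < T.card ∧
      (T.sort (· ≤ ·)).getD ((T.sort (· ≤ ·)).idxOf t) 0 = t := by
    intro t ht
    have : (T.sort (· ≤ ·)).idxOf t < (T.sort (· ≤ ·)).length :=
      List.idxOf_lt_length_iff.2 ((Finset.mem_sort _).2 ht)
    refine ⟨by simpa using this, ?_⟩
    rw [List.getD_eq_getElem _ _ this]
    simp
  apply Finset.card_le_card_of_injOn
    (fun t => (B.sort (· ≤ ·)).getD ((T.sort (· ≤ ·)).idxOf t) 0)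
  · intro t ht
    simp only [Finset.coe_filter, Set.mem_ofPred_eq] at ht ⊢
    obtain ⟨k1, k2⟩ := key t ht.1
    have := h _ k1
    rw [k2] at this
    refine ⟨?_, by omega⟩
    have hl : (T.sort (· ≤ ·)).idxOf t < (B.sort (· ≤ ·)).length := by
      rw [Finset.length_sort, ← hc]; exact k1
    rw [List.getD_eq_getElem _ _ hl]
    exact (Finset.mem_sort _).1 (List.getElem_mem _)
  · intro t ht t' ht' he
    simp only [Finset.coe_filter, Set.mem_ofPred_eq] at ht ht'
    obtain ⟨k1, k2⟩ := key t ht.1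
    obtain ⟨k1', k2'⟩ := key t' ht'.1
    have hl : (T.sort (· ≤ ·)).idxOf t < (B.sort (· ≤ ·)).length := by
      rw [Finset.length_sort, ← hc]; exact k1
    have hl' : (T.sort (· ≤ ·)).idxOf t' < (B.sort (· ≤ ·)).length := by
      rw [Finset.length_sort, ← hc]; exact k1'
    simp only at he
    rw [List.getD_eq_getElem _ _ hl, List.getD_eq_getElem _ _ hl',
      (Finset.sort_nodup B (· ≤ ·)).getElem_inj_iff] at he
    rw [← k2, ← k2', he]

lemma dcnt_eq_sum (x : ℕ) (w : List ℕ) : dcnt x w = ∑ m ∈ Finset.range w.length,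
    if m + 1 < w.length ∧ w.getD (m + 1) 0 < x ∧ x < w.getD m 0 then 1 else 0 := by
  induction w with
  | nil => simp [dcnt]
  | cons y w ih =>
    rw [dcnt, ih, List.length_cons, Finset.sum_range_succ', add_comm]
    congr 1
    · apply Finset.sum_congr rfl
      intro m _
      simp
    · cases w with
      | nil => simp; omega
      | cons z w => simp

lemma pst_eq_sum (w : List ℕ) : pst w = ∑ j ∈ Finset.range w.length, ∑ m ∈ Finset.range w.length,
    if j < m ∧ m + 1 < w.length ∧ w.getD (m + 1) 0 < w.getD j 0 ∧ w.getD j 0 < w.getD m 0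
      then 1 else 0 := by
  induction w with
  | nil => simp [pst]
  | cons y w ih =>
    rw [pst, ih, dcnt_eq_sum, List.length_cons, Finset.sum_range_succ', add_comm]
    congr 1
    · apply Finset.sum_congr rfl
      intro j _
      rw [Finset.sum_range_succ']
      simp
    · rw [Finset.sum_range_succ']
      simp

lemma countP_eq_sum (f : ℕ → Bool) (w : List ℕ) : w.countP f = ∑ j ∈ Finset.range w.length,
    if f (w.getD j 0) then 1 else 0 := by
  induction w with
  | nil => simp
  | cons y w ih =>
    rw [List.countP_cons, ih, List.length_cons, Finset.sum_range_succ']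
    simp

lemma qst_eq_sum (w : List ℕ) : qst w = ∑ m ∈ Finset.range w.length, ∑ j ∈ Finset.range w.length,
    if m + 1 < j ∧ w.getD (m + 1) 0 < w.getD j 0 ∧ w.getD j 0 < w.getD m 0
      then 1 else 0 := by
  induction w with
  | nil => simp [qst]
  | cons y w ih =>
    rw [qst, ih, countP_eq_sum, List.length_cons, Finset.sum_range_succ', add_comm]
    congr 1
    · apply Finset.sum_congr rfl
      intro j _
      rw [Finset.sum_range_succ']
      simp
    · rw [Finset.sum_range_succ']
      simp only [inbt_iff]
      cases w with
      | nil => simp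
      | cons z w =>
        simp only [List.headD_cons, List.getD_cons_succ, List.getD_cons_zero]
        rw [show (if 0 + 1 < 0 ∧ z < y ∧ y < y then 1 else 0) = 0 by simp, add_zero]
        apply Finset.sum_congr rfl
        intro j _
        rcases j with _ | j
        · simp
        · simp

/-- the word of a permutation, with a final infinite letter `n + 1` -/
def word {n : ℕ} (σ : Equiv.Perm (Fin n)) : List ℕ :=
  List.ofFn (fun k : Fin n => (σ k : ℕ) + 1) ++ [n + 1]

lemma word_length {n : ℕ} (σ : Equiv.Perm (Fin n)) : (word σ).length = n + 1 := by
  simp [word]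

lemma word_getD {n : ℕ} (σ : Equiv.Perm (Fin n)) {k : ℕ} (hk : k < n) :
    (word σ).getD k 0 = entry σ (k + 1) := by
  rw [List.getD_eq_getElem _ _ (by rw [word_length]; omega)]
  simp [word, entry, hk]

lemma word_getD_last {n : ℕ} (σ : Equiv.Perm (Fin n)) : (word σ).getD n 0 = n + 1 := by
  rw [List.getD_eq_getElem _ _ (by rw [word_length]; omega)]
  simp [word]

lemma entry_le {n : ℕ} (σ : Equiv.Perm (Fin n)) (k : ℕ) : entry σ k ≤ n := by
  unfold entry; split_ifs
  · omega
  · omega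

lemma entry_pos {n : ℕ} (σ : Equiv.Perm (Fin n)) {k : ℕ} (h1 : 1 ≤ k) (h2 : k ≤ n) :
    1 ≤ entry σ k := by
  unfold entry; split_ifs
  · omega
  · omega

lemma entry_inj {n : ℕ} (σ : Equiv.Perm (Fin n)) {j k : ℕ} (h1 : 1 ≤ k) (h2 : k ≤ n)
    (h3 : 1 ≤ j) (h4 : j ≤ n) (h : entry σ j = entry σ k) : j = k := by
  unfold entry at h
  rw [dif_pos (by omega), dif_pos (by omega)] at h
  have := σ.injective (Fin.ext (Nat.add_right_cancel h))
  simp at this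
  omega

lemma entry_surj {n : ℕ} (σ : Equiv.Perm (Fin n)) {x : ℕ} (h1 : 1 ≤ x) (h2 : x ≤ n) :
    ∃ k, 1 ≤ k ∧ k ≤ n ∧ entry σ k = x := by
  obtain ⟨k, hk⟩ := σ.surjective ⟨x - 1, by omega⟩
  refine ⟨k + 1, by omega, by omega, ?_⟩
  simp [entry, hk]
  omega

lemma pst_word {n : ℕ} (σ : Equiv.Perm (Fin n)) : pst (word σ) = occ2_31 σ := by
  rw [pst_eq_sum, ← Finset.sum_product', ← Finset.card_filter, occ2_31, word_length]
  apply Finset.card_nbij' (fun p => (p.1 + 1, p.2 + 1)) (fun p => (p.1 - 1, p.2 - 1))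
  · rintro ⟨j, m⟩ h
    simp only [Finset.coe_filter, Finset.mem_product, Finset.mem_range, Set.mem_ofPred_eq,
      Finset.mem_Icc] at h ⊢
    obtain ⟨-, h1, h2, h3, h4⟩ := h
    have hm : m + 1 < n := by
      by_contra hm
      have : m + 1 = n := by omega
      rw [this, word_getD_last, word_getD σ (by omega)] at h3
      have := entry_le σ (j + 1)
      omega
    rw [word_getD σ hm, word_getD σ (by omega)] at h3
    rw [word_getD σ (by omega), word_getD σ (by omega)] at h4
    refine ⟨⟨⟨?_, ?_⟩, ?_, ?_⟩, ?_, ?_, ?_, ?_⟩ <;> omega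
  · rintro ⟨j, m⟩ h
    simp only [Finset.coe_filter, Finset.mem_product, Finset.mem_range, Set.mem_ofPred_eq,
      Finset.mem_Icc] at h ⊢
    obtain ⟨⟨⟨a1, a2⟩, a3, a4⟩, h1, h2, h3, h4⟩ := h
    rw [word_getD σ (by omega), word_getD σ (by omega), word_getD σ (by omega)]
    rw [show m - 1 + 1 = m by omega, show j - 1 + 1 = j by omega]
    refine ⟨⟨?_, ?_⟩, ?_, ?_, ?_, ?_⟩ <;> omega
  · rintro ⟨j, m⟩ h
    simp
  · rintro ⟨j, m⟩ h
    simp only [Finset.coe_filter, Finset.mem_product, Finset.mem_range, Set.mem_ofPred_eq,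
      Finset.mem_Icc] at h ⊢
    simp; omega

lemma qst_word {n : ℕ} (σ : Equiv.Perm (Fin n)) : qst (word σ) = occ31_2 σ := by
  rw [qst_eq_sum, ← Finset.sum_product', ← Finset.card_filter, occ31_2, word_length]
  apply Finset.card_nbij' (fun p => (p.1 + 1, p.2 + 1)) (fun p => (p.1 - 1, p.2 - 1))
  · rintro ⟨m, j⟩ h
    simp only [Finset.coe_filter, Finset.mem_product, Finset.mem_range, Set.mem_ofPred_eq,
      Finset.mem_Icc] at h ⊢
    obtain ⟨⟨-, a2⟩, h1, h3, h4⟩ := h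
    have hm : j < n := by
      by_contra hm
      have : j = n := by omega
      rw [this, word_getD_last, word_getD σ (by omega)] at h4
      have := entry_le σ (m + 1)
      omega
    rw [word_getD σ (by omega), word_getD σ (by omega)] at h3
    rw [word_getD σ (by omega), word_getD σ (by omega)] at h4
    refine ⟨⟨⟨?_, ?_⟩, ?_, ?_⟩, ?_, ?_, ?_, ?_⟩ <;> omega
  · rintro ⟨m, j⟩ h
    simp only [Finset.coe_filter, Finset.mem_product, Finset.mem_range, Set.mem_ofPred_eq,
      Finset.mem_Icc] at h ⊢
    obtain ⟨⟨⟨a1, a2⟩, a3, a4⟩, h1, h2, h3, h4⟩ := h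
    rw [word_getD σ (by omega), word_getD σ (by omega), word_getD σ (by omega)]
    rw [show m - 1 + 1 = m by omega, show j - 1 + 1 = j by omega]
    refine ⟨⟨?_, ?_⟩, ?_, ?_, ?_⟩ <;> omega
  · rintro ⟨j, m⟩ h
    simp
  · rintro ⟨j, m⟩ h
    simp only [Finset.coe_filter, Finset.mem_product, Finset.mem_range, Set.mem_ofPred_eq,
      Finset.mem_Icc] at h ⊢
    simp; omega

lemma word_inj {n : ℕ} : Function.Injective (word (n := n)) := by
  intro σ τ h
  simp only [word, List.append_cancel_right_eq] at h
  have := List.ofFn_injective h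
  ext k
  have := congrFun this k
  simp at this
  simp [this]

lemma chain_word {n : ℕ} {T B : Finset ℕ} (σ : Equiv.Perm (Fin n)) :
    List.IsChain (Adj (n + 1) T B) (0 :: word σ) ↔
      Adj (n + 1) T B 0 ((word σ).getD 0 0) ∧
      ∀ k, k < n → Adj (n + 1) T B ((word σ).getD k 0) ((word σ).getD (k + 1) 0) := by
  have hl := word_length σ
  rw [List.isChain_iff_getElem]
  constructor
  · intro h
    constructor
    · have := h 0 (by simp [hl])
      rw [List.getD_eq_getElem _ _ (by omega)]
      simpa using this
    · intro k hk
      have := h (k + 1) (by simp [hl]; omega)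
      rw [List.getD_eq_getElem _ _ (by omega), List.getD_eq_getElem _ _ (by omega)]
      simpa using this
  · rintro ⟨h0, h⟩ k hk
    rcases k with _ | k
    · rw [List.getD_eq_getElem _ _ (by omega)] at h0
      simpa using h0
    · simp [hl] at hk
      have := h k (by omega)
      rw [List.getD_eq_getElem _ _ (by omega), List.getD_eq_getElem _ _ (by omega)] at this
      simpa using this

lemma chain_word_iff {n : ℕ} {T B : Finset ℕ} (σ : Equiv.Perm (Fin n))
    (hT : T ⊆ Finset.Icc 1 n) (hB : B ⊆ Finset.Icc 1 n) :
    List.IsChain (Adj (n + 1) T B) (0 :: word σ) ↔ Destop σ = T ∧ Desbot σ = B := by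
  rw [chain_word]
  constructor
  · rintro ⟨h0, h⟩
    constructor
    · ext t
      simp only [Destop, Des, Finset.mem_image, Finset.mem_filter, Finset.mem_Icc]
      constructor
      · rintro ⟨j, ⟨⟨h1, h2⟩, h3⟩, rfl⟩
        have := (h (j - 1) (by omega)).2.1
        rw [word_getD σ (by omega), word_getD σ (by omega), show j - 1 + 1 = j by omega] at this
        have h4 := entry_le σ j
        exact (this (by omega)).1 h3
      · intro ht
        have ht' := Finset.mem_Icc.1 (hT ht)
        obtain ⟨j, h1, h2, rfl⟩ := entry_surj σ ht'.1 ht'.2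
        have := (h (j - 1) (by omega)).2.1
        rw [word_getD σ (by omega), show j - 1 + 1 = j by omega] at this
        have := (this (by omega)).2 ht
        have hj : j < n := by
          by_contra hj
          have e : j = n := by omega
          rw [e, word_getD_last] at this
          have := entry_le σ n
          omega
        rw [word_getD σ hj] at this
        exact ⟨j, ⟨⟨by omega, by omega⟩, this⟩, rfl⟩
    · ext t
      simp only [Desbot, Des, Finset.mem_image, Finset.mem_filter, Finset.mem_Icc]
      constructor
      · rintro ⟨j, ⟨⟨h1, h2⟩, h3⟩, rfl⟩
        have := (h (j - 1) (by omega)).2.2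
        rw [word_getD σ (by omega), word_getD σ (by omega), show j - 1 + 1 = j by omega] at this
        have h4 := entry_le σ (j + 1)
        exact (this (by omega)).1 h3
      · intro ht
        have ht' := Finset.mem_Icc.1 (hB ht)
        obtain ⟨j, h1, h2, rfl⟩ := entry_surj σ ht'.1 ht'.2
        by_cases hj : j = 1
        · subst hj
          have := h0.2.2
          rw [word_getD σ (by omega)] at this
          have := (this (by simp; omega)).2 ht
          omega
        · have := (h (j - 2) (by omega)).2.2
          rw [word_getD σ (by omega), word_getD σ (by omega),
            show j - 2 + 1 = j - 1 by omega, show j - 1 + 1 = j by omega] at this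
          have := (this (by omega)).2 ht
          refine ⟨j - 1, ⟨⟨by omega, by omega⟩, ?_⟩, ?_⟩
          · rw [show j - 1 + 1 = j by omega]; exact this
          · rw [show j - 1 + 1 = j by omega]
  · rintro ⟨rfl, rfl⟩
    have memT : ∀ j, 1 ≤ j → j ≤ n → (entry σ j ∈ Destop σ ↔
        j < n ∧ entry σ (j + 1) < entry σ j) := by
      intro j h1 h2
      simp only [Destop, Des, Finset.mem_image, Finset.mem_filter, Finset.mem_Icc]
      constructor
      · rintro ⟨m, ⟨⟨a, b⟩, c⟩, d⟩
        have := entry_inj σ h1 h2 a (by omega) d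
        subst this
        exact ⟨by omega, c⟩
      · rintro ⟨a, b⟩
        exact ⟨j, ⟨⟨by omega, by omega⟩, b⟩, rfl⟩
    have memB : ∀ j, 1 ≤ j → j ≤ n → (entry σ j ∈ Desbot σ ↔
        1 < j ∧ entry σ j < entry σ (j - 1)) := by
      intro j h1 h2
      simp only [Desbot, Des, Finset.mem_image, Finset.mem_filter, Finset.mem_Icc]
      constructor
      · rintro ⟨m, ⟨⟨a, b⟩, c⟩, d⟩
        have := entry_inj σ h1 h2 (by omega) (by omega) d
        subst this
        exact ⟨by omega, by simpa using c⟩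
      · rintro ⟨a, b⟩
        refine ⟨j - 1, ⟨⟨by omega, by omega⟩, ?_⟩, ?_⟩
        · rw [show j - 1 + 1 = j by omega]; exact b
        · rw [show j - 1 + 1 = j by omega]
    constructor
    · refine ⟨by omega, ?_, ?_⟩
      · intro _
        constructor
        · intro h; omega
        · intro h
          have := Finset.mem_Icc.1 (hT h)
          omega
      · rcases Nat.eq_zero_or_pos n with h | h
        · subst h
          rw [word_getD_last]; simp
        · rw [word_getD σ h, memB _ (by omega) (by omega)]
          intro _
          omega
    · intro k hk
      have hle := entry_le σ (k + 1)
      rw [word_getD σ hk]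
      by_cases hk' : k + 1 < n
      · rw [word_getD σ hk']
        refine ⟨by omega, ?_, ?_⟩
        · intro _
          rw [memT _ (by omega) (by omega)]
          tauto
        · intro _
          rw [memB _ (by omega) (by omega)]
          simp
      · have e : k + 1 = n := by omega
        have hw := word_getD_last σ
        rw [e] at hle ⊢
        rw [hw]
        refine ⟨by omega, ?_, ?_⟩
        · intro _
          rw [memT _ (by omega) (by omega)]
          omega
        · intro h; exact absurd rfl h

lemma valid_word_iff {n : ℕ} {T B : Finset ℕ} (σ : Equiv.Perm (Fin n))
    (hT : T ⊆ Finset.Icc 1 n) (hB : B ⊆ Finset.Icc 1 n) :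
    Valid (n + 1) T B n (word σ) ↔ Destop σ = T ∧ Desbot σ = B := by
  rw [← chain_word_iff σ hT hB]
  refine ⟨fun h => h.chain, fun h => ⟨?_, ?_, h, _, rfl⟩⟩
  · intro x hx
    simp only [word, List.mem_append, List.mem_ofFn, List.mem_singleton] at hx
    rcases hx with ⟨k, rfl⟩ | hx
    · left; omega
    · right; exact hx
  · intro x h1 h2
    have hx : ¬ n + 1 = x := by omega
    rw [word, List.count_append]
    have : ([n + 1] : List ℕ).count x = 0 := by simp [hx]
    rw [this, add_zero]
    apply List.count_eq_one_of_mem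
    · rw [List.nodup_ofFn]
      intro a b hab
      simp at hab
      exact σ.injective (Fin.ext hab)
    · rw [List.mem_ofFn]
      obtain ⟨k, hk⟩ := σ.surjective ⟨x - 1, by omega⟩
      refine ⟨k, ?_⟩
      simp [hk]; omega

lemma word_surj {n : ℕ} {T B : Finset ℕ} {w : List ℕ} (hw : Valid (n + 1) T B n w)
    (hc : w.count (n + 1) = 1) : ∃ σ : Equiv.Perm (Fin n), word σ = w := by
  obtain ⟨hm, hcn, -, w0, rfl⟩ := hw
  have hN : n + 1 ∉ w0 := by
    rw [← List.count_eq_zero]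
    simpa [List.count_append] using hc
  have hm0 : ∀ x ∈ w0, 1 ≤ x ∧ x ≤ n := by
    intro x hx
    rcases hm x (by simp [hx]) with h | h
    · exact h
    · subst h; exact absurd hx hN
  have hc0 : ∀ x, 1 ≤ x → x ≤ n → w0.count x = 1 := by
    intro x h1 h2
    have hx : ¬ n + 1 = x := by omega
    have := hcn x h1 h2
    rw [List.count_append] at this
    simpa [hx] using this
  have hnd : w0.Nodup := by
    rw [List.nodup_iff_count_le_one]
    intro x
    by_cases hx : x ∈ w0
    · have := hm0 x hx
      rw [hc0 x this.1 this.2]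
    · rw [List.count_eq_zero.2 hx]; omega
  have hlen : w0.length = n := by
    have e : w0.toFinset = Finset.Icc 1 n := by
      ext x
      rw [List.mem_toFinset, Finset.mem_Icc]
      refine ⟨hm0 x, fun h => ?_⟩
      rw [← List.count_pos_iff, hc0 x h.1 h.2]; omega
    have := List.toFinset_card_of_nodup hnd
    rw [e] at this
    simpa using this.symm
  let f : Fin n → Fin n := fun k => ⟨w0[(k : ℕ)]'(by omega) - 1, by
    have := hm0 _ (List.getElem_mem (l := w0) (n := (k : ℕ)) (by omega))
    omega⟩
  have hf : Function.Injective f := by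
    intro a b hab
    have ha := hm0 _ (List.getElem_mem (l := w0) (n := (a : ℕ)) (by omega))
    have hb := hm0 _ (List.getElem_mem (l := w0) (n := (b : ℕ)) (by omega))
    have hab := congrArg Fin.val hab
    simp only [f] at hab
    have : w0[(a : ℕ)]'(by omega) = w0[(b : ℕ)]'(by omega) := by omega
    rw [hnd.getElem_inj_iff] at this
    exact Fin.ext this
  refine ⟨Equiv.ofBijective f (Finite.injective_iff_bijective.1 hf), ?_⟩
  rw [word]
  congr 1
  apply List.ext_getElem
  · simp [hlen]
  · intro k h1 h2
    have ha := hm0 _ (List.getElem_mem (l := w0) (n := k) h2)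
    simp [f]
    omega

/-- For any descent matching `(T, B)` with `T ⊆ [n]`, in `ℤ[p, q]`,
`Σ_{σ ∈ S_n, Destop σ = T, Desbot σ = B} p^{(2-31)σ} q^{(31-2)σ}
  = Π_{i=1}^{n} [sg_{n,(T,B)}(i)]_{p,q}`. -/
theorem occ_generating_function_prod (n : ℕ) (T B : Finset ℕ)
    (hTB : DescentMatching T B) (hT : T ⊆ Finset.Icc 1 n) :
    ∑ σ ∈ (Finset.univ : Finset (Equiv.Perm (Fin n))).filter
        (fun σ => Destop σ = T ∧ Desbot σ = B),
      (MvPolynomial.X 0 : MvPolynomial (Fin 2) ℤ) ^ occ2_31 σ *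
        (MvPolynomial.X 1 : MvPolynomial (Fin 2) ℤ) ^ occ31_2 σ =
    ∏ i ∈ Finset.Icc 1 n,
      genQInt (sg T B i) (MvPolynomial.X 0 : MvPolynomial (Fin 2) ℤ) (MvPolynomial.X 1) := by

  have hn : n < n + 1 := by omega
  have h0 : 0 ∉ T := fun h => absurd (hTB.2.1 0 h) (by omega)
  have h0B : 0 ∉ B := fun h => absurd (hTB.2.2.1 0 h) (by omega)
  have hd := matching_le hTB
  have hTn : T.filter (fun t => t ≤ n) = T := by
    apply Finset.filter_true_of_mem
    intro x hx
    exact (Finset.mem_Icc.1 (hT hx)).2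
  have hB' : B.filter (fun b => b < n) = B := by
    apply Finset.eq_of_subset_of_card_le (Finset.filter_subset _ _)
    have := hd n
    rw [hTn] at this
    rw [← hTB.1]
    exact this
  have hBlt : ∀ b ∈ B, b < n := fun b hb => by
    rw [← hB'] at hb
    exact (Finset.mem_filter.1 hb).2
  have hB : B ⊆ Finset.Icc 1 n := by
    intro b hb
    rw [Finset.mem_Icc]
    have := hBlt b hb
    have := hTB.2.2.1 b hb
    omega
  have hBn : B.filter (fun t => t ≤ n) = B := by
    apply Finset.filter_true_of_mem
    intro x hx
    exact (hBlt x hx).le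
  rw [← states_sum _ _ h0 h0B hd n hn,
    ← List.sum_toFinset _ (nodup_states h0 n hn)]
  apply Finset.sum_bij (fun σ _ => word σ)
  · intro σ hσ
    rw [Finset.mem_filter] at hσ
    rw [List.mem_toFinset, mem_states h0 n hn, valid_word_iff σ hT hB]
    exact hσ.2
  · intro σ _ τ _ h
    exact word_inj h
  · intro w hw
    rw [List.mem_toFinset] at hw
    have hc := count_N h0 h0B n hn w hw
    rw [hTn, hBn, hTB.1] at hc
    rw [mem_states h0 n hn] at hw
    obtain ⟨σ, rfl⟩ := word_surj hw (by omega)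
    refine ⟨σ, ?_, rfl⟩
    rw [Finset.mem_filter]
    exact ⟨Finset.mem_univ _, (valid_word_iff σ hT hB).1 hw⟩
  · intro σ _
    rw [pst_word, qst_word]
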